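/- For n ∈ ℕ, n ≥ 1, define I_n := (1/(2π n²)) ∫_{−∞}^{∞} (1/(1 + k²)) · (1 − cos k)/(1 − cos(k/n)) dk (the integrand has only removable singularities). Then lim_{n→∞} I_n = 1/e. Equivalently, for the functions ψ̂_n(k) = (2π)^{−1/2} (1 − e^{−ik}) / ((1 − e^{−ik/n})(1 + k²)) one has lim_{n→∞} n^{−2}(‖ψ̂_n‖²_{L²(ℝ)} + ‖k ψ̂_n‖²_{L²(ℝ)}) = 1/e. -/

import Mathlib

/- STATEMENT 19: With `I_n = (1/(2π n²)) ∫_ℝ (1/(1+k²))·(1-cos k)/(1-cos(k/n)) dk`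
one has `I_n → 1/e`; equivalently, for
`ψ̂_n(k) = (2π)^{-1/2}(1 - e^{-ik})/((1 - e^{-ik/n})(1 + k²))` one has
`n⁻²(‖ψ̂_n‖²_{L²} + ‖k ψ̂_n‖²_{L²}) → 1/e`. -/

open MeasureTheory

/-- The function `ψ̂_n(k) = (2π)^{-1/2} (1 - e^{-ik}) / ((1 - e^{-ik/n})(1 + k²))`. -/
noncomputable def psiHat (n : ℕ) (k : ℝ) : ℂ :=
  (Real.sqrt (2 * Real.pi) : ℂ)⁻¹ * (1 - Complex.exp (-(Complex.I * k))) /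
    ((1 - Complex.exp (-(Complex.I * k / n))) * (1 + (k : ℂ) ^ 2))

open Filter Topology FourierTransform

/-- The integrals of `e^{-|x|}` against characters, split at the origin. -/
lemma integrable_and_integral_exp_mul_exp_neg_abs (s : ℝ) :
    Integrable (fun x : ℝ => Complex.exp ((s * x : ℝ) * Complex.I) * (Real.exp (-|x|) : ℂ)) ∧
    ∫ x : ℝ, Complex.exp ((s * x : ℝ) * Complex.I) * (Real.exp (-|x|) : ℂ) =
      ((2 * (1 + s ^ 2)⁻¹ : ℝ) : ℂ) := by
  set a : ℂ := 1 + s * Complex.I with ha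
  set b : ℂ := -1 + s * Complex.I with hb
  have hare : 0 < a.re := by simp [ha]
  have hbre : b.re < 0 := by simp [hb]
  have ha0 : a ≠ 0 := fun h => by simp [h] at hare
  have hb0 : b ≠ 0 := fun h => by simp [h] at hbre
  have hL : Set.EqOn (fun x : ℝ => Complex.exp (a * x)) (fun x : ℝ =>
      Complex.exp ((s * x : ℝ) * Complex.I) * (Real.exp (-|x|) : ℂ)) (Set.Iic 0) := by
    intro x hx
    simp only [abs_of_nonpos (Set.mem_Iic.mp hx), ha]
    push_cast
    rw [← Complex.exp_add]
    congr 1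
    ring
  have hR : Set.EqOn (fun x : ℝ => Complex.exp (b * x)) (fun x : ℝ =>
      Complex.exp ((s * x : ℝ) * Complex.I) * (Real.exp (-|x|) : ℂ)) (Set.Ioi 0) := by
    intro x hx
    simp only [abs_of_pos (Set.mem_Ioi.mp hx), hb]
    push_cast
    rw [← Complex.exp_add]
    congr 1
    ring
  have hiL := (integrableOn_exp_mul_complex_Iic hare 0).congr_fun hL measurableSet_Iic
  have hiR := (integrableOn_exp_mul_complex_Ioi hbre 0).congr_fun hR measurableSet_Ioi
  constructor
  · rw [← integrableOn_univ, ← Set.Iic_union_Ioi (a := (0 : ℝ))]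
    exact hiL.union hiR
  · rw [← intervalIntegral.integral_Iic_add_Ioi hiL hiR,
      ← setIntegral_congr_fun measurableSet_Iic hL, ← setIntegral_congr_fun measurableSet_Ioi hR,
      integral_exp_mul_complex_Iic hare, integral_exp_mul_complex_Ioi hbre]
    have hs : (1 + (s : ℂ) ^ 2) ≠ 0 := by
      exact_mod_cast (by positivity : (1 + s ^ 2 : ℝ) ≠ 0)
    have hab : a * b = -(1 + (s : ℂ) ^ 2) := by
      simp only [ha, hb]
      linear_combination (s : ℂ) ^ 2 * Complex.I_sq
    have hba : b - a = -2 := by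
      simp only [ha, hb]
      ring
    have : Complex.exp (a * (0 : ℝ)) / a + -Complex.exp (b * (0 : ℝ)) / b = (b - a) / (a * b) := by
      simp only [Complex.ofReal_zero, mul_zero, Complex.exp_zero]
      field_simp
      ring
    rw [this, hab, hba]
    push_cast
    field_simp

lemma fourier_exp_neg_abs (w : ℝ) :
    𝓕 (fun x : ℝ => (Real.exp (-|x|) : ℂ)) w = ((2 * (1 + (2 * Real.pi * w) ^ 2)⁻¹ : ℝ) : ℂ) := by
  rw [Real.fourier_real_eq_integral_exp_smul]
  have h := (integrable_and_integral_exp_mul_exp_neg_abs (-(2 * Real.pi * w))).2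
  rw [neg_sq] at h
  rw [← h]
  congr 1 with x
  rw [smul_eq_mul]
  congr 4
  ring

lemma integrable_two_mul_inv_one_add_two_pi_mul_sq :
    Integrable (fun w : ℝ => 2 * (1 + (2 * Real.pi * w) ^ 2)⁻¹) :=
  ((integrable_inv_one_add_sq.comp_mul_left' (by positivity : 2 * Real.pi ≠ 0))).const_mul 2

/-- The characteristic function of the Cauchy distribution, in real form. -/
lemma integral_inv_one_add_sq_mul_cos (t : ℝ) :
    ∫ k : ℝ, (1 + k ^ 2)⁻¹ * Real.cos (t * k) = Real.pi * Real.exp (-|t|) := by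
  have hfour : 𝓕 (fun x : ℝ => (Real.exp (-|x|) : ℂ)) =
      fun w : ℝ => ((2 * (1 + (2 * Real.pi * w) ^ 2)⁻¹ : ℝ) : ℂ) := funext fourier_exp_neg_abs
  have hint : Integrable (fun x : ℝ => (Real.exp (-|x|) : ℂ)) := by
    simpa using (integrable_and_integral_exp_mul_exp_neg_abs 0).1
  have hfint : Integrable (𝓕 (fun x : ℝ => (Real.exp (-|x|) : ℂ))) := by
    rw [hfour]
    exact integrable_two_mul_inv_one_add_two_pi_mul_sq.ofReal
  have hinv := congrFun (Continuous.fourierInv_fourier_eq (by fun_prop) hint hfint) t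
  rw [hfour, Real.fourierInv_eq'] at hinv
  have hre := congrArg Complex.re hinv
  rw [Complex.ofReal_re, ← RCLike.re_to_complex, ← integral_re] at hre
  · have hpt : ∀ w : ℝ, RCLike.re (Complex.exp (↑(2 * Real.pi * inner ℝ w t) * Complex.I) •
        ((2 * (1 + (2 * Real.pi * w) ^ 2)⁻¹ : ℝ) : ℂ)) =
        (fun k : ℝ => 2 * ((1 + k ^ 2)⁻¹ * Real.cos (t * k))) (2 * Real.pi * w) := by
      intro w
      rw [smul_eq_mul, RCLike.re_to_complex, Complex.re_mul_ofReal, Complex.exp_ofReal_mul_I_re]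
      simp only [RCLike.inner_apply, conj_trivial]
      rw [show 2 * Real.pi * (t * w) = t * (2 * Real.pi * w) by ring]
      ring
    rw [integral_congr_ae (ae_of_all _ hpt), Measure.integral_comp_mul_left
        (fun k : ℝ => 2 * ((1 + k ^ 2)⁻¹ * Real.cos (t * k))), integral_const_mul,
      abs_of_pos (by positivity : 0 < (2 * Real.pi)⁻¹), smul_eq_mul] at hre
    rw [inv_mul_eq_iff_eq_mul₀ (by positivity), mul_assoc] at hre
    exact mul_left_cancel₀ two_ne_zero hre
  · refine integrable_two_mul_inv_one_add_two_pi_mul_sq.ofReal.bdd_mul (c := 1)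
      (by fun_prop) (ae_of_all _ fun w => ?_)
    rw [Complex.norm_exp_ofReal_mul_I]

lemma integral_one_sub_mul_cos {k : ℝ} (hk : k ≠ 0) :
    ∫ t in (0 : ℝ)..1, (1 - t) * Real.cos (t * k) = (1 - Real.cos k) / k ^ 2 := by
  have hderiv : ∀ t ∈ Set.uIcc (0 : ℝ) 1, HasDerivAt
      (fun t => (1 - t) * (Real.sin (t * k) / k) - Real.cos (t * k) / k ^ 2)
      ((1 - t) * Real.cos (t * k)) t := by
    intro t _
    have hl : HasDerivAt (fun t : ℝ => t * k) k t := by simpa using (hasDerivAt_id t).mul_const k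
    refine ((((hasDerivAt_id' t).const_sub 1).mul (hl.sin.div_const k)).sub
      (hl.cos.div_const (k ^ 2))).congr_deriv ?_
    field_simp
    ring
  rw [intervalIntegral.integral_eq_sub_of_hasDerivAt hderiv
    (Continuous.intervalIntegrable (by fun_prop) _ _)]
  simp
  ring

lemma integral_one_sub_mul_exp_neg :
    ∫ t in (0 : ℝ)..1, (1 - t) * Real.exp (-t) = 1 / Real.exp 1 := by
  have hderiv : ∀ t ∈ Set.uIcc (0 : ℝ) 1, HasDerivAt (fun t => t * Real.exp (-t))
      ((1 - t) * Real.exp (-t)) t := by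
    intro t _
    refine ((hasDerivAt_id' t).mul (hasDerivAt_neg t).exp).congr_deriv ?_
    ring
  rw [intervalIntegral.integral_eq_sub_of_hasDerivAt hderiv
    (Continuous.intervalIntegrable (by fun_prop) _ _)]
  simp [Real.exp_neg]

lemma integral_inv_one_add_sq_mul_one_sub_cos_div_sq :
    ∫ k : ℝ, (1 + k ^ 2)⁻¹ * ((1 - Real.cos k) / k ^ 2) = Real.pi / Real.exp 1 := by
  have hint : Integrable (Function.uncurry fun (k t : ℝ) =>
      (1 + k ^ 2)⁻¹ * ((1 - t) * Real.cos (t * k)))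
      (volume.prod (volume.restrict (Set.Ioc 0 1))) := by
    have hone : Integrable (fun t : ℝ => |1 - t|) (volume.restrict (Set.Ioc 0 1)) :=
      (Continuous.integrableOn_Icc (by fun_prop)).mono_set Set.Ioc_subset_Icc_self
    refine (integrable_inv_one_add_sq.mul_prod hone).mono'
      (Measurable.aestronglyMeasurable (by fun_prop)) (ae_of_all _ fun p => ?_)
    simp only [Function.uncurry, Real.norm_eq_abs, abs_mul]
    rw [abs_of_pos (by positivity : 0 < (1 + p.1 ^ 2)⁻¹)]
    gcongr
    exact mul_le_of_le_one_right (abs_nonneg _) (Real.abs_cos_le_one _)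
  calc ∫ k : ℝ, (1 + k ^ 2)⁻¹ * ((1 - Real.cos k) / k ^ 2)
      = ∫ k : ℝ, ∫ t in Set.Ioc (0 : ℝ) 1, (1 + k ^ 2)⁻¹ * ((1 - t) * Real.cos (t * k)) := by
        refine integral_congr_ae ?_
        filter_upwards [Measure.ae_ne volume (0 : ℝ)] with k hk
        rw [integral_const_mul, ← intervalIntegral.integral_of_le zero_le_one,
          integral_one_sub_mul_cos hk]
    _ = ∫ t in Set.Ioc (0 : ℝ) 1, ∫ k : ℝ, (1 + k ^ 2)⁻¹ * ((1 - t) * Real.cos (t * k)) :=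
        integral_integral_swap hint
    _ = ∫ t in Set.Ioc (0 : ℝ) 1, Real.pi * ((1 - t) * Real.exp (-t)) := by
        refine setIntegral_congr_fun measurableSet_Ioc fun t ht => ?_
        simp only [mul_left_comm _ (1 - t)]
        rw [integral_const_mul, integral_inv_one_add_sq_mul_cos, abs_of_pos ht.1]
    _ = Real.pi / Real.exp 1 := by
        rw [integral_const_mul, ← intervalIntegral.integral_of_le zero_le_one,
          integral_one_sub_mul_exp_neg, mul_one_div]

lemma abs_sin_nat_mul_le (n : ℕ) (x : ℝ) : |Real.sin (n * x)| ≤ n * |Real.sin x| := by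
  induction n with
  | zero => simp
  | succ n ih =>
    push_cast
    rw [add_mul, one_mul, Real.sin_add]
    calc |Real.sin (n * x) * Real.cos x + Real.cos (n * x) * Real.sin x|
        ≤ |Real.sin (n * x)| * |Real.cos x| + |Real.cos (n * x)| * |Real.sin x| := by
          simpa only [abs_mul] using
            abs_add_le (Real.sin (n * x) * Real.cos x) (Real.cos (n * x) * Real.sin x)
      _ ≤ n * |Real.sin x| * 1 + 1 * |Real.sin x| := by
          gcongr
          · exact Real.abs_cos_le_one _
          · exact Real.abs_cos_le_one _
      _ = (n + 1) * |Real.sin x| := by ring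

lemma one_sub_cos_eq_two_mul_sin_sq (x : ℝ) : 1 - Real.cos x = 2 * Real.sin (x / 2) ^ 2 := by
  rw [Real.sin_sq_eq_half_sub, mul_div_cancel₀ x two_ne_zero]
  ring

lemma one_sub_cos_div_nonneg (x y : ℝ) : 0 ≤ (1 - Real.cos x) / (1 - Real.cos y) :=
  div_nonneg (sub_nonneg.mpr (Real.cos_le_one x)) (sub_nonneg.mpr (Real.cos_le_one y))

lemma one_sub_cos_div_le {n : ℕ} (hn : n ≠ 0) (k : ℝ) :
    (1 - Real.cos k) / (1 - Real.cos (k / n)) ≤ (n : ℝ) ^ 2 := by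
  refine div_le_of_le_mul₀ (sub_nonneg.mpr (Real.cos_le_one _)) (by positivity) ?_
  have hn' : (n : ℝ) ≠ 0 := Nat.cast_ne_zero.mpr hn
  have h := abs_sin_nat_mul_le n (k / n / 2)
  rw [show (n : ℝ) * (k / n / 2) = k / 2 by field_simp] at h
  have hsq := pow_le_pow_left₀ (abs_nonneg _) h 2
  rw [mul_pow, sq_abs, sq_abs] at hsq
  rw [one_sub_cos_eq_two_mul_sin_sq, one_sub_cos_eq_two_mul_sin_sq (k / n)]
  linarith

lemma measurable_inv_one_add_sq_mul_one_sub_cos_div (n : ℕ) : Measurable fun k : ℝ =>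
    1 / (1 + k ^ 2) * ((1 - Real.cos k) / (1 - Real.cos (k / n))) := by
  fun_prop

lemma norm_inv_one_add_sq_mul_one_sub_cos_div_le {n : ℕ} (hn : n ≠ 0) (k : ℝ) :
    ‖1 / (1 + k ^ 2) * ((1 - Real.cos k) / (1 - Real.cos (k / n)))‖ ≤
      (n : ℝ) ^ 2 * (1 + k ^ 2)⁻¹ := by
  rw [Real.norm_of_nonneg (mul_nonneg (by positivity) (one_sub_cos_div_nonneg _ _)), one_div,
    mul_comm]
  gcongr
  exact one_sub_cos_div_le hn k

lemma integrable_inv_one_add_sq_mul_one_sub_cos_div {n : ℕ} (hn : n ≠ 0) :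
    Integrable fun k : ℝ => 1 / (1 + k ^ 2) * ((1 - Real.cos k) / (1 - Real.cos (k / n))) :=
  (integrable_inv_one_add_sq.const_mul _).mono'
    (measurable_inv_one_add_sq_mul_one_sub_cos_div n).aestronglyMeasurable
    (ae_of_all _ (norm_inv_one_add_sq_mul_one_sub_cos_div_le hn))

lemma tendsto_sq_mul_one_sub_cos_div (k : ℝ) :
    Tendsto (fun n : ℕ => (n : ℝ) ^ 2 * (1 - Real.cos (k / n))) atTop (𝓝 (k ^ 2 / 2)) := by
  rcases eq_or_ne k 0 with rfl | hk
  · simp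
  have hx : Tendsto (fun n : ℕ => k / n / 2) atTop (𝓝 0) := by
    simpa using (tendsto_const_div_atTop_nhds_zero_nat k).div_const 2
  have hs := ((Real.continuous_sinc.tendsto 0).comp hx).pow 2 |>.const_mul (k ^ 2 / 2)
  rw [Real.sinc_zero, one_pow, mul_one] at hs
  refine hs.congr' ?_
  filter_upwards [eventually_ne_atTop 0] with n hn
  have hn' : (n : ℝ) ≠ 0 := Nat.cast_ne_zero.mpr hn
  rw [one_sub_cos_eq_two_mul_sin_sq, Function.comp_apply, Real.sinc_of_ne_zero (by positivity)]
  field_simp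

/-- Dominated convergence for the normalised kernels. -/
lemma tendsto_integral_inv_one_add_sq_mul_one_sub_cos_div :
    Tendsto (fun n : ℕ => (1 / (2 * Real.pi * (n : ℝ) ^ 2)) *
        ∫ k : ℝ, (1 / (1 + k ^ 2)) * ((1 - Real.cos k) / (1 - Real.cos (k / n))))
      atTop (𝓝 (1 / Real.exp 1)) := by
  have hlim : Tendsto (fun n : ℕ => ∫ k : ℝ, ((n : ℝ) ^ 2)⁻¹ *
      (1 / (1 + k ^ 2) * ((1 - Real.cos k) / (1 - Real.cos (k / n))))) atTop
      (𝓝 (∫ k : ℝ, 2 * ((1 + k ^ 2)⁻¹ * ((1 - Real.cos k) / k ^ 2)))) := by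
    refine tendsto_integral_filter_of_dominated_convergence (fun k : ℝ => (1 + k ^ 2)⁻¹)
      (Eventually.of_forall fun n =>
        ((measurable_inv_one_add_sq_mul_one_sub_cos_div n).const_mul _).aestronglyMeasurable)
      ?_ integrable_inv_one_add_sq ?_
    · filter_upwards [eventually_ne_atTop 0] with n hn
      refine ae_of_all _ fun k => ?_
      have hn' : (0 : ℝ) < (n : ℝ) ^ 2 := by positivity
      rw [norm_mul, Real.norm_of_nonneg (inv_nonneg.mpr hn'.le), inv_mul_le_iff₀ hn']
      exact norm_inv_one_add_sq_mul_one_sub_cos_div_le hn k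
    · filter_upwards [Measure.ae_ne volume (0 : ℝ)] with k hk
      have h := ((tendsto_sq_mul_one_sub_cos_div k).inv₀ (by positivity)).const_mul
        ((1 + k ^ 2)⁻¹ * (1 - Real.cos k))
      convert h using 2 <;> field_simp
  rw [integral_const_mul, integral_inv_one_add_sq_mul_one_sub_cos_div_sq] at hlim
  convert hlim.const_mul (1 / (2 * Real.pi)) using 2
  · rw [integral_const_mul]
    field_simp
  · field_simp

lemma norm_one_sub_exp_neg_I_mul_sq (x : ℝ) :
    ‖1 - Complex.exp (-(Complex.I * x))‖ ^ 2 = 2 * (1 - Real.cos x) := by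
  have h := Complex.norm_exp_I_mul_ofReal_sub_one (-x)
  rw [Complex.ofReal_neg, mul_neg] at h
  rw [norm_sub_rev, h, one_sub_cos_eq_two_mul_sin_sq, Real.norm_eq_abs, sq_abs, neg_div,
    Real.sin_neg]
  ring

lemma norm_psiHat_sq (n : ℕ) (k : ℝ) : ‖psiHat n k‖ ^ 2 = (2 * Real.pi)⁻¹ *
    ((1 + k ^ 2)⁻¹ * (1 / (1 + k ^ 2) * ((1 - Real.cos k) / (1 - Real.cos (k / n))))) := by
  have hk : ‖(1 : ℂ) + (k : ℂ) ^ 2‖ = 1 + k ^ 2 := by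
    rw [← Complex.ofReal_pow, ← Complex.ofReal_one, ← Complex.ofReal_add, Complex.norm_real,
      Real.norm_of_nonneg (by positivity)]
  have hp : ‖(Real.sqrt (2 * Real.pi) : ℂ)⁻¹‖ ^ 2 = (2 * Real.pi)⁻¹ := by
    rw [norm_inv, Complex.norm_real, Real.norm_of_nonneg (Real.sqrt_nonneg _), inv_pow,
      Real.sq_sqrt (by positivity)]
  have he := norm_one_sub_exp_neg_I_mul_sq (k / n)
  rw [Complex.ofReal_div, Complex.ofReal_natCast, ← mul_div_assoc] at he
  rw [psiHat, norm_div, norm_mul, norm_mul, div_pow, mul_pow, mul_pow, hp, hk,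
    norm_one_sub_exp_neg_I_mul_sq, he, mul_assoc 2, mul_left_comm _ 2,
    mul_div_mul_left _ _ two_ne_zero]
  field_simp

lemma integral_norm_psiHat_sq_add {n : ℕ} (hn : n ≠ 0) :
    (∫ k : ℝ, ‖psiHat n k‖ ^ 2) + ∫ k : ℝ, ‖(k : ℂ) * psiHat n k‖ ^ 2 =
      (2 * Real.pi)⁻¹ *
        ∫ k : ℝ, (1 / (1 + k ^ 2)) * ((1 - Real.cos k) / (1 - Real.cos (k / n))) := by
  have hJ := integrable_inv_one_add_sq_mul_one_sub_cos_div hn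
  have hmul : ∀ k : ℝ, ‖(k : ℂ) * psiHat n k‖ ^ 2 = k ^ 2 * ‖psiHat n k‖ ^ 2 := fun k => by
    rw [norm_mul, mul_pow, Complex.norm_real, Real.norm_eq_abs, sq_abs]
  have hbdd : Integrable fun k : ℝ => ‖psiHat n k‖ ^ 2 := by
    simp_rw [norm_psiHat_sq]
    refine (hJ.bdd_mul (c := 1) (Measurable.aestronglyMeasurable (by fun_prop))
      (ae_of_all _ fun k => ?_)).const_mul _
    rw [Real.norm_of_nonneg (by positivity)]
    exact inv_le_one_of_one_le₀ (le_add_of_nonneg_right (sq_nonneg k))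
  have hsum : ∀ k : ℝ, ‖psiHat n k‖ ^ 2 + ‖(k : ℂ) * psiHat n k‖ ^ 2 = (2 * Real.pi)⁻¹ *
      (1 / (1 + k ^ 2) * ((1 - Real.cos k) / (1 - Real.cos (k / n)))) := fun k => by
    have hk : (1 + k ^ 2) * (1 + k ^ 2)⁻¹ = 1 := mul_inv_cancel₀ (by positivity)
    rw [hmul, norm_psiHat_sq]
    linear_combination ((2 * Real.pi)⁻¹ *
      (1 / (1 + k ^ 2) * ((1 - Real.cos k) / (1 - Real.cos (k / n))))) * hk
  have hbdd' : Integrable fun k : ℝ => ‖(k : ℂ) * psiHat n k‖ ^ 2 :=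
    ((hJ.const_mul (2 * Real.pi)⁻¹).sub hbdd).congr
      (ae_of_all _ fun k => sub_eq_of_eq_add' (hsum k).symm)
  rw [← integral_add hbdd hbdd', ← integral_const_mul]
  exact integral_congr_ae (ae_of_all _ hsum)

theorem statement19 :
    Filter.Tendsto
      (fun n : ℕ => (1 / (2 * Real.pi * (n : ℝ) ^ 2)) *
        ∫ k : ℝ, (1 / (1 + k ^ 2)) * ((1 - Real.cos k) / (1 - Real.cos (k / n))))
      Filter.atTop (nhds (1 / Real.exp 1)) ∧
    Filter.Tendsto
      (fun n : ℕ => ((n : ℝ) ^ 2)⁻¹ *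
        ((∫ k : ℝ, ‖psiHat n k‖ ^ 2) + ∫ k : ℝ, ‖(k : ℂ) * psiHat n k‖ ^ 2))
      Filter.atTop (nhds (1 / Real.exp 1)) := by
  refine ⟨tendsto_integral_inv_one_add_sq_mul_one_sub_cos_div,
    tendsto_integral_inv_one_add_sq_mul_one_sub_cos_div.congr' ?_⟩
  filter_upwards [eventually_ne_atTop 0] with n hn
  rw [integral_norm_psiHat_sq_add hn]
  field_simp
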